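/- Let f be the explicit piecewise map defined in the context with parameters λ = 4/5, σ = −5/4, c₂ = −1/2, d₁ = 1, d₅ = 1. Then there exists an integer k_min such that for every even integer k ≥ k_min: (i) there is a point p ∈ ℝ² with f^{k+1}(p) = p whose periodic orbit is asymptotically stable, and (ii) there is a point q ∈ ℝ² with f^{k+1}(q) = q such that the Jacobian matrix of f^{k+1} at q has real eigenvalues μ₁, μ₂ with |μ₁| < 1 < |μ₂|. -/

import Mathlib

open Filter Metric

noncomputable section

/-- Jacobian matrix of a planar map at a point. -/
def jac (T : ℝ × ℝ → ℝ × ℝ) (z : ℝ × ℝ) : Matrix (Fin 2) (Fin 2) ℝ :=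
  !![fderiv ℝ (fun p => (T p).1) z (1, 0), fderiv ℝ (fun p => (T p).1) z (0, 1);
     fderiv ℝ (fun p => (T p).2) z (1, 0), fderiv ℝ (fun p => (T p).2) z (0, 1)]

/-- The forward orbit of a point under a planar map. -/
def orbit (f : ℝ × ℝ → ℝ × ℝ) (p : ℝ × ℝ) : Set (ℝ × ℝ) :=
  Set.range fun n : ℕ => f^[n] p

/-- A periodic orbit (through `p`) is Lyapunov stable if every forward orbit starting
close enough to the orbit stays close to it. -/
def LyapStable (f : ℝ × ℝ → ℝ × ℝ) (p : ℝ × ℝ) : Prop :=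
  ∀ ε > 0, ∃ δ > 0, ∀ q : ℝ × ℝ, infDist q (orbit f p) < δ →
    ∀ n : ℕ, infDist (f^[n] q) (orbit f p) < ε

/-- Asymptotic stability: Lyapunov stability together with local attractivity. -/
def AsympStable (f : ℝ × ℝ → ℝ × ℝ) (p : ℝ × ℝ) : Prop :=
  LyapStable f p ∧ ∃ δ > 0, ∀ q : ℝ × ℝ, infDist q (orbit f p) < δ →
    Tendsto (fun n : ℕ => infDist (f^[n] q) (orbit f p)) atTop (nhds 0)

/-- `h₀ = (2|λ|+1)/3`. -/
def h0 (lam : ℝ) : ℝ := (2 * |lam| + 1) / 3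

/-- `h₁ = (|λ|+2)/3`. -/
def h1 (lam : ℝ) : ℝ := (|lam| + 2) / 3

/-- `U₀(x,y) = (λx, σy)`. -/
def Umap0 (lam sig : ℝ) (p : ℝ × ℝ) : ℝ × ℝ := (lam * p.1, sig * p.2)

/-- `U₁(x,y) = (1 + c₂(y−1), d₁x + d₅(y−1)²)`. -/
def Umap1 (c₂ d₁ d₅ : ℝ) (p : ℝ × ℝ) : ℝ × ℝ :=
  (1 + c₂ * (p.2 - 1), d₁ * p.1 + d₅ * (p.2 - 1) ^ 2)

/-- `s(z) = 3z² − 2z³`. -/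
def sfun (z : ℝ) : ℝ := 3 * z ^ 2 - 2 * z ^ 3

/-- `r(y) = s((y−h₀)/(h₁−h₀))`. -/
def rfun (lam : ℝ) (y : ℝ) : ℝ := sfun ((y - h0 lam) / (h1 lam - h0 lam))

/-- The explicit piecewise map of the example. -/
def fmap (lam sig c₂ d₁ d₅ : ℝ) (p : ℝ × ℝ) : ℝ × ℝ :=
  if p.2 ≤ h0 lam then Umap0 lam sig p
  else if h1 lam ≤ p.2 then Umap1 c₂ d₁ d₅ p
  else (1 - rfun lam p.2) • Umap0 lam sig p + rfun lam p.2 • Umap1 c₂ d₁ d₅ p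

/-- A property of points that holds near `p`, and is inherited backwards along `f` by points
close to the orbit of `p`, holds near the whole orbit of a periodic point `p`. -/
lemma exists_forall_infDist_orbit_lt {f : ℝ × ℝ → ℝ × ℝ} (hf : Continuous f) {p : ℝ × ℝ} {m : ℕ}
    (hm : 0 < m) (hp : f^[m] p = p) {P : ℝ × ℝ → Prop} (h₀ : ∀ᶠ q in nhds p, P q)
    (hback : ∀ x ∈ orbit f p, ∀ᶠ q in nhds x, P (f q) → P q) :
    ∃ δ > 0, ∀ q, infDist q (orbit f p) < δ → P q := by
  have hmod (n : ℕ) : f^[n % m] p = f^[n] p :=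
    Function.IsPeriodicPt.iterate_mod_apply (f := f) hp n
  have hfin : (orbit f p).Finite := by
    refine ((Finset.range m).finite_toSet.image fun n => f^[n] p).subset ?_
    rintro _ ⟨n, rfl⟩
    exact ⟨n % m, by simpa using Nat.mod_lt n hm, hmod n⟩
  have hdown : ∀ i ≤ m, ∀ᶠ q in nhds (f^[m - i] p), P q := by
    intro i
    induction i with
    | zero => intro _; simpa [hp] using h₀
    | succ i ih =>
      intro hi
      have h := ih (by lia)
      have hs : f^[m - i] p = f (f^[m - (i + 1)] p) := by
        rw [← Function.iterate_succ_apply' f]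
        congr 2
        lia
      rw [hs] at h
      filter_upwards [hf.continuousAt.eventually h, hback _ ⟨m - (i + 1), rfl⟩] with q h₁ h₂
      exact h₂ h₁
  have hall : ∀ x ∈ orbit f p, ∀ᶠ q in nhds x, P q := by
    rintro _ ⟨n, rfl⟩
    have hlt := Nat.mod_lt n hm
    have := hdown (m - n % m) (by lia)
    rwa [show m - (m - n % m) = n % m by lia, hmod n] at this
  obtain ⟨δ, hδ, hsub⟩ := hfin.isCompact.exists_thickening_subset_open
    (isOpen_interior (s := {q | P q})) fun x hx => mem_interior_iff_mem_nhds.2 (hall x hx)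
  refine ⟨δ, hδ, fun q hq => ?_⟩
  have hne : (orbit f p).Nonempty := ⟨p, 0, rfl⟩
  exact interior_subset (hsub ((mem_thickening_iff_infDist_lt hne).2 hq))

/-- A periodic point at which the return map contracts distances has an asymptotically stable
orbit. -/
lemma asympStable_of_eventually_dist_le {f : ℝ × ℝ → ℝ × ℝ} (hf : Continuous f) {p : ℝ × ℝ}
    {m : ℕ} (hm : 0 < m) (hp : f^[m] p = p) {c : ℝ} (hc₀ : 0 ≤ c) (hc : c < 1)
    (hcontr : ∀ᶠ q in nhds p, dist (f^[m] q) p ≤ c * dist q p) : AsympStable f p := by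
  obtain ⟨ρ, hρ, hball⟩ := Metric.eventually_nhds_iff.1 hcontr
  have hmem (n : ℕ) : f^[n] p ∈ orbit f p := ⟨n, rfl⟩
  have hpow {q : ℝ × ℝ} (hq : dist q p < ρ) (j : ℕ) :
      dist (f^[m * j] q) p ≤ c ^ j * dist q p := by
    induction j with
    | zero => simp
    | succ j ih =>
      have hle : c ^ j * dist q p ≤ dist q p :=
        mul_le_of_le_one_left dist_nonneg (pow_le_one₀ hc₀ hc.le)
      have := hball (ih.trans_lt (hle.trans_lt hq))
      rw [← Function.iterate_add_apply] at this
      rw [show m * (j + 1) = m + m * j by ring, pow_succ']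
      calc _ ≤ c * dist (f^[m * j] q) p := this
        _ ≤ c * (c ^ j * dist q p) := by gcongr
        _ = _ := by ring
  have hstab (ε : ℝ) (hε : 0 < ε) :
      ∀ᶠ q in nhds p, ∀ n, infDist (f^[n] q) (orbit f p) < ε := by
    have hfirst : ∀ᶠ q in nhds p, ∀ i ∈ Finset.range m, dist (f^[i] q) (f^[i] p) < ε :=
      (Finset.eventually_all _).2 fun i _ =>
        ((hf.iterate i).continuousAt (x := p)).eventually (Metric.ball_mem_nhds _ hε)
    obtain ⟨η, hη, hclose⟩ := Metric.eventually_nhds_iff.1 hfirst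
    filter_upwards [Metric.ball_mem_nhds p (lt_min hη hρ)] with q hq n
    rw [Metric.mem_ball, lt_min_iff] at hq
    have hle : c ^ (n / m) * dist q p ≤ dist q p :=
      mul_le_of_le_one_left dist_nonneg (pow_le_one₀ hc₀ hc.le)
    have := hclose (((hpow hq.2 (n / m)).trans hle).trans_lt hq.1) (n % m)
      (Finset.mem_range.2 (Nat.mod_lt n hm))
    rw [← Function.iterate_add_apply, Nat.mod_add_div] at this
    exact (infDist_le_dist_of_mem (hmem _)).trans_lt this
  refine ⟨fun ε hε => ?_, ?_⟩
  · refine exists_forall_infDist_orbit_lt hf hm hp (hstab ε hε) fun x hx => ?_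
    filter_upwards [Metric.ball_mem_nhds x hε] with q hq h n
    cases n with
    | zero => exact (infDist_le_dist_of_mem hx).trans_lt hq
    | succ n => exact h n
  · refine exists_forall_infDist_orbit_lt hf hm hp ?_ fun x _ => .of_forall fun q h =>
      (tendsto_add_atTop_iff_nat 1).1 h
    filter_upwards [Metric.ball_mem_nhds p hρ] with q hq
    rw [Metric.tendsto_atTop]
    intro ε hε
    obtain ⟨η, hη, hclose⟩ := Metric.eventually_nhds_iff.1 (hstab ε hε)
    have hlim : Tendsto (fun j => c ^ j * dist q p) atTop (nhds 0) := by
      simpa using (tendsto_pow_atTop_nhds_zero_of_lt_one hc₀ hc).mul_const (dist q p)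
    obtain ⟨j, hj⟩ := (hlim.eventually_lt_const hη).exists
    refine ⟨m * j, fun n hn => ?_⟩
    have := hclose ((hpow hq j).trans_lt hj) (n - m * j)
    rw [← Function.iterate_add_apply, Nat.sub_add_cancel hn] at this
    rwa [Real.dist_eq, sub_zero, abs_of_nonneg infDist_nonneg]

lemma continuous_fmap {lam : ℝ} (hlam : |lam| < 1) (sig c₂ d₁ d₅ : ℝ) :
    Continuous (fmap lam sig c₂ d₁ d₅) := by
  have h01 : h0 lam < h1 lam := by unfold h0 h1; linarith
  have hr : Continuous fun p : ℝ × ℝ => rfun lam p.2 := by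
    unfold rfun sfun; fun_prop
  have hU₀ : Continuous (Umap0 lam sig) := by unfold Umap0; fun_prop
  have hU₁ : Continuous (Umap1 c₂ d₁ d₅) := by unfold Umap1; fun_prop
  unfold fmap
  refine hU₀.if_le (Continuous.if_le hU₁ (by fun_prop) continuous_const continuous_snd ?_)
    continuous_snd continuous_const ?_
  · intro p hp
    have : rfun lam p.2 = 1 := by
      rw [rfun, ← hp, div_self (sub_ne_zero.2 h01.ne')]
      norm_num [sfun]
    simp [this]
  · intro p hp
    have : rfun lam p.2 = 0 := by simp [rfun, hp, sfun]
    rw [if_neg (by rw [hp]; exact h01.not_ge)]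
    simp [this]

lemma h0_four_fifths : h0 (4 / 5) = 13 / 15 := by
  rw [h0, abs_of_nonneg (by norm_num)]; norm_num

lemma h1_four_fifths : h1 (4 / 5) = 14 / 15 := by
  rw [h1, abs_of_nonneg (by norm_num)]; norm_num

lemma fmap_iterate_eq_linear {k j : ℕ} (hj : j ≤ k) {z : ℝ × ℝ}
    (hz : |z.2| * (5 / 4) ^ k < 13 / 12) :
    (fmap (4/5) (-5/4) (-1/2) 1 1)^[j] z = ((4 / 5) ^ j * z.1, (-5 / 4) ^ j * z.2) := by
  induction j with
  | zero => simp
  | succ j ih =>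
    have hpow : (5 / 4 : ℝ) ^ j * (5 / 4) ≤ (5 / 4) ^ k := by
      rw [← pow_succ]; exact pow_le_pow_right₀ (by norm_num) hj
    have hle : (-5 / 4 : ℝ) ^ j * z.2 ≤ 13 / 15 := by
      refine (le_abs_self _).trans ?_
      rw [abs_mul, abs_pow, show |(-5 / 4 : ℝ)| = 5 / 4 by norm_num [abs_of_neg]]
      nlinarith [mul_le_mul_of_nonneg_left hpow (abs_nonneg z.2)]
    rw [Function.iterate_succ_apply', ih (by lia), fmap, if_pos (by rwa [h0_four_fifths])]
    simp only [Umap0, Prod.mk.injEq]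
    constructor <;> ring

/-- The first-return map near the tangential homoclinic point, with `E = |σ|ᵏ`. -/
def returnMap (E : ℝ) (z : ℝ × ℝ) : ℝ × ℝ :=
  (1 - 1 / 2 * (E * z.2 - 1), E⁻¹ * z.1 + (E * z.2 - 1) ^ 2)

lemma fmap_iterate_eq_returnMap {k : ℕ} (hk : Even k) {z : ℝ × ℝ}
    (hlow : 14 / 15 < (5 / 4) ^ k * z.2) (hup : (5 / 4) ^ k * z.2 < 13 / 12) :
    (fmap (4/5) (-5/4) (-1/2) 1 1)^[k + 1] z = returnMap ((5 / 4) ^ k) z := by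
  have hE : (0 : ℝ) < (5 / 4) ^ k := by positivity
  have hz : 0 < z.2 := pos_of_mul_pos_right (by linarith) hE.le
  have hsig : (-5 / 4 : ℝ) ^ k = (5 / 4) ^ k := by
    rw [show (-5 / 4 : ℝ) = -(5 / 4) by norm_num, hk.neg_pow]
  have hlam : (4 / 5 : ℝ) ^ k = ((5 / 4) ^ k)⁻¹ := by rw [← inv_pow]; norm_num
  rw [Function.iterate_succ_apply', fmap_iterate_eq_linear le_rfl
    (by rwa [abs_of_pos hz, mul_comm]), hsig, hlam, fmap,
    if_neg (by rw [h0_four_fifths]; simp only; linarith),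
    if_pos (by rw [h1_four_fifths]; exact hlow.le)]
  simp only [Umap1, returnMap, Prod.mk.injEq]
  constructor <;> ring

lemma eventually_fmap_iterate_eq_returnMap {k : ℕ} (hk : Even k) {z : ℝ × ℝ}
    (hlow : 14 / 15 < (5 / 4) ^ k * z.2) (hup : (5 / 4) ^ k * z.2 < 13 / 12) :
    (fmap (4/5) (-5/4) (-1/2) 1 1)^[k + 1] =ᶠ[nhds z] returnMap ((5 / 4) ^ k) := by
  have hc : Continuous fun w : ℝ × ℝ => (5 / 4 : ℝ) ^ k * w.2 := by fun_prop
  filter_upwards [hc.continuousAt.eventually (lt_mem_nhds hlow),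
    hc.continuousAt.eventually (gt_mem_nhds hup)] with w h₁ h₂
  exact fmap_iterate_eq_returnMap hk h₁ h₂

lemma hasFDerivAt_returnMap_fst (E : ℝ) (z : ℝ × ℝ) :
    HasFDerivAt (fun p => (returnMap E p).1) (-(E / 2) • ContinuousLinearMap.snd ℝ ℝ ℝ) z := by
  unfold returnMap
  refine HasFDerivAt.congr_fderiv ((((hasFDerivAt_snd (p := z)).const_mul E).sub_const 1).const_mul
    (1 / 2) |>.const_sub 1) ?_
  ext <;> simp
  ring

lemma hasFDerivAt_returnMap_snd (E : ℝ) (z : ℝ × ℝ) :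
    HasFDerivAt (fun p => (returnMap E p).2) (E⁻¹ • ContinuousLinearMap.fst ℝ ℝ ℝ +
      (2 * (E * z.2 - 1) * E) • ContinuousLinearMap.snd ℝ ℝ ℝ) z := by
  unfold returnMap
  refine HasFDerivAt.congr_fderiv (((hasFDerivAt_fst (p := z)).const_mul E⁻¹).add
    ((((hasFDerivAt_snd (p := z)).const_mul E).sub_const 1).pow 2)) ?_
  ext <;> simp

lemma jac_returnMap (E : ℝ) (z : ℝ × ℝ) :
    jac (returnMap E) z = !![0, -(E / 2); E⁻¹, 2 * (E * z.2 - 1) * E] := by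
  simp [jac, (hasFDerivAt_returnMap_fst E z).fderiv, (hasFDerivAt_returnMap_snd E z).fderiv]

lemma jac_congr {S T : ℝ × ℝ → ℝ × ℝ} {z : ℝ × ℝ} (h : S =ᶠ[nhds z] T) : jac S z = jac T z := by
  have h₁ : fderiv ℝ (fun p => (S p).1) z = fderiv ℝ (fun p => (T p).1) z :=
    (h.fun_comp Prod.fst).fderiv_eq
  have h₂ : fderiv ℝ (fun p => (S p).2) z = fderiv ℝ (fun p => (T p).2) z :=
    (h.fun_comp Prod.snd).fderiv_eq
  rw [jac, jac, h₁, h₂]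

/-- The derivative of the twice iterated return map is `-1/2` at the fixed point `(1, E⁻¹)`. -/
lemma hasFDerivAt_returnMap_iterate_two {E : ℝ} (hE : E ≠ 0) :
    HasFDerivAt (returnMap E)^[2] ((-1 / 2 : ℝ) • ContinuousLinearMap.id ℝ (ℝ × ℝ)) (1, E⁻¹) := by
  have hfix : returnMap E (1, E⁻¹) = (1, E⁻¹) := by simp [returnMap, hE]
  have h := ((hasFDerivAt_returnMap_fst E (1, E⁻¹)).prodMk
    (hasFDerivAt_returnMap_snd E (1, E⁻¹))).iterate hfix 2
  refine h.congr_fderiv ?_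
  ext <;> simp [pow_two, hE] <;> field_simp

theorem example_orientation_reversing_coexistence :
    ∃ kmin : ℕ, ∀ k : ℕ, kmin ≤ k → Even k →
      (∃ p : ℝ × ℝ, (fmap (4/5) (-5/4) (-1/2) 1 1)^[k + 1] p = p ∧
        AsympStable (fmap (4/5) (-5/4) (-1/2) 1 1) p) ∧
      (∃ q : ℝ × ℝ, (fmap (4/5) (-5/4) (-1/2) 1 1)^[k + 1] q = q ∧
        ∃ μ₁ μ₂ : ℝ,
          μ₁ + μ₂ = Matrix.trace (jac ((fmap (4/5) (-5/4) (-1/2) 1 1)^[k + 1]) q) ∧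
          μ₁ * μ₂ = (jac ((fmap (4/5) (-5/4) (-1/2) 1 1)^[k + 1]) q).det ∧
          |μ₁| < 1 ∧ 1 < |μ₂|) := by
  refine ⟨14, fun k hk heven => ?_⟩
  set E : ℝ := (5 / 4) ^ k with hEdef
  have hElow : 18 < E :=
    lt_of_lt_of_le (by norm_num) (pow_le_pow_right₀ (by norm_num : (1 : ℝ) ≤ 5 / 4) hk)
  have hE : E ≠ 0 := by linarith
  constructor
  · have hval : E * ((1, E⁻¹) : ℝ × ℝ).2 = 1 := mul_inv_cancel₀ hE
    have hloc := eventually_fmap_iterate_eq_returnMap heven (z := (1, E⁻¹))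
      (by rw [← hEdef, hval]; norm_num) (by rw [← hEdef, hval]; norm_num)
    rw [← hEdef] at hloc
    have hfix : (fmap (4/5) (-5/4) (-1/2) 1 1)^[k + 1] (1, E⁻¹) = (1, E⁻¹) := by
      rw [hloc.eq_of_nhds]
      simp [returnMap, hE]
    have hcont : Continuous (fmap (4/5) (-5/4) (-1/2) 1 1) :=
      continuous_fmap (by norm_num [abs_of_nonneg]) _ _ _ _
    have hloc₂ : (fmap (4/5) (-5/4) (-1/2) 1 1)^[(k + 1) * 2] =ᶠ[nhds (1, E⁻¹)]
        (returnMap E)^[2] := by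
      have hback := (hcont.iterate (k + 1)).continuousAt (x := (1, E⁻¹))
      rw [ContinuousAt, hfix] at hback
      filter_upwards [hloc, hback.eventually hloc] with q h₁ h₂
      rw [Function.iterate_mul]
      simp only [Function.iterate_succ, Function.iterate_zero, Function.comp, id] at h₁ h₂ ⊢
      rw [h₂, h₁]
    have hfix₂ : (fmap (4/5) (-5/4) (-1/2) 1 1)^[(k + 1) * 2] (1, E⁻¹) = (1, E⁻¹) := by
      rw [Function.iterate_mul]
      exact Function.iterate_fixed hfix 2
    refine ⟨_, hfix, asympStable_of_eventually_dist_le hcont (by positivity) hfix₂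
      (c := 3 / 4) (by norm_num) (by norm_num) ?_⟩
    have hder := (hasFDerivAt_returnMap_iterate_two hE).congr_of_eventuallyEq hloc₂
    filter_upwards [hder.isLittleO.def (c := 1 / 4) (by norm_num)] with q hq
    rw [hfix₂] at hq
    set w := (fmap (4/5) (-5/4) (-1/2) 1 1)^[(k + 1) * 2] q - (1, E⁻¹) with hw
    rw [dist_eq_norm, dist_eq_norm, ← hw]
    have htri := norm_add_le (w - (-1 / 2 : ℝ) • (q - (1, E⁻¹))) ((-1 / 2 : ℝ) • (q - (1, E⁻¹)))
    rw [sub_add_cancel, norm_smul, show ‖(-1 / 2 : ℝ)‖ = 1 / 2 by norm_num] at htri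
    simp only [smul_apply, ContinuousLinearMap.id_apply] at hq
    linarith
  · set z : ℝ × ℝ := (1 - 3 / 4 * E⁻¹, E⁻¹ + 3 / 2 * E⁻¹ ^ 2) with hz
    have hval : E * z.2 = 1 + 3 / 2 * E⁻¹ := by simp only [hz]; field_simp
    have hpos : 0 < E⁻¹ := by positivity
    have hsmall : E⁻¹ < 1 / 18 := by
      rw [inv_lt_comm₀ (by linarith) (by norm_num)]; linarith
    have hloc := eventually_fmap_iterate_eq_returnMap heven (z := z)
      (by rw [← hEdef, hval]; linarith) (by rw [← hEdef, hval]; linarith)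
    rw [← hEdef] at hloc
    refine ⟨z, ?_, (3 - √7) / 2, (3 + √7) / 2, ?_, ?_, ?_, ?_⟩
    · rw [hloc.eq_of_nhds, returnMap, hval, hz]
      ext <;> simp <;> ring
    · rw [jac_congr hloc, jac_returnMap, Matrix.trace_fin_two_of, hval]
      field_simp
      ring
    · rw [jac_congr hloc, jac_returnMap, Matrix.det_fin_two_of]
      have := Real.sq_sqrt (show (0 : ℝ) ≤ 7 by norm_num)
      field_simp
      linarith
    · have h₁ : 2 < √7 := Real.lt_sqrt_of_sq_lt (by norm_num)
      have h₂ : √7 < 3 := (Real.sqrt_lt' (by norm_num)).2 (by norm_num)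
      rw [abs_lt]
      constructor <;> linarith
    · rw [lt_abs]
      left
      linarith [Real.sqrt_nonneg 7]
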